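/- arXiv:math/0503034 — 4 statements merged into one kernel-verified Lean document; each statement's English description precedes it below -/
import Mathlib

section
/- Let η ∈ V*, set λ = iη ∈ V*_ℂ, and let w ∈ W₀. Then, with ρ_ν^k = Σ_{α∈Σ₀⁺} α∨/(ν(α∨) + k_α) ∈ V_ℂ (well defined for any purely imaginary ν since k_α > 0), K_λ^k(v) = v + Σ_{α∈Σ₀} k_α·α(v)·α∨/(k_α² − λ(α∨)²) (all denominators equal k_α² + η(α∨)² > 0), and s_φ acting on V_ℂ by s_φ(x) = x − φ(x)φ∨, the following identity holds in V_ℂ: K_λ^k(w⁻¹φ∨) = w⁻¹(ρ_{wλ}^k) − w⁻¹(s_φ(ρ_{s_φ(wλ)}^k)) + (((wλ)(φ∨)² − k_φ² − 2k_φ)/((wλ)(φ∨)² − k_φ²))·w⁻¹φ∨, where the denominator (wλ)(φ∨)² − k_φ² = −(wη)(φ∨)² − k_φ² is nonzero. -/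
open scoped BigOperators
open RealInnerProductSpace

noncomputable section

/-- The coroot `α∨` of a root `α`, under the identification of `V*` with `V`
via the inner product: `ξ(α∨) = 2⟨ξ,α⟩/‖α‖²`. -/
def coroot {V : Type*} [NormedAddCommGroup V] [InnerProductSpace ℝ V] (α : V) : V :=
  (2 / ‖α‖ ^ 2) • α

/-- The orthogonal reflection `s_α` in the hyperplane orthogonal to `α`:
`s_α(ξ) = ξ − ξ(α∨)·α = ξ − α(ξ)·α∨`. -/
def sRefl {V : Type*} [NormedAddCommGroup V] [InnerProductSpace ℝ V] (α v : V) : V :=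
  v - ⟪α, v⟫ • coroot α

/-- A finite, irreducible, reduced, crystallographic root system `Σ₀` in the dual of
the Euclidean space `V` (identified with `V` via the inner product), together with a
fixed base of simple roots, the positive roots, and the highest root. -/
structure RootSystemBase (V : Type*) [NormedAddCommGroup V] [InnerProductSpace ℝ V]
    [FiniteDimensional ℝ V] where
  roots : Finset V
  roots_nonempty : roots.Nonempty
  ne_zero : ∀ α ∈ roots, α ≠ (0 : V)
  /-- reduced -/
  reduced : ∀ α ∈ roots, ∀ c : ℝ, c • α ∈ roots → c = 1 ∨ c = -1
  /-- crystallographic: `β(α∨) ∈ ℤ` -/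
  crystallographic : ∀ α ∈ roots, ∀ β ∈ roots, ∃ m : ℤ, ⟪β, coroot α⟫ = (m : ℝ)
  /-- stable under the reflections `s_α` -/
  refl_mem : ∀ α ∈ roots, ∀ β ∈ roots, sRefl α β ∈ roots
  /-- `Σ₀` spans `V*` -/
  spanning : Submodule.span ℝ (roots : Set V) = ⊤
  /-- irreducible: no nontrivial orthogonal decomposition -/
  irreducible : ∀ s : Finset V, s ⊆ roots →
    (∀ α ∈ s, ∀ β ∈ roots, β ∉ s → ⟪α, β⟫ = 0) → s = ∅ ∨ s = roots
  /-- the fixed base of simple roots -/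
  simples : Finset V
  simples_sub : simples ⊆ roots
  simples_indep : LinearIndependent ℝ (fun β : {x // x ∈ simples} => (β : V))
  /-- the positive roots w.r.t. the base -/
  pos : Finset V
  pos_sub : pos ⊆ roots
  simples_sub_pos : simples ⊆ pos
  pos_or_neg : ∀ α ∈ roots, (α ∈ pos ∧ -α ∉ pos) ∨ (α ∉ pos ∧ -α ∈ pos)
  pos_combo : ∀ α ∈ pos, ∃ c : V → ℝ, (∀ β, 0 ≤ c β) ∧ α = ∑ β ∈ simples, c β • β
  /-- the highest root `φ` -/
  hroot : V
  hroot_pos : hroot ∈ pos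
  hroot_highest : ∀ α ∈ roots, ∃ c : V → ℝ, (∀ β, 0 ≤ c β) ∧
    hroot - α = ∑ β ∈ simples, c β • β

variable {V : Type*} [NormedAddCommGroup V] [InnerProductSpace ℝ V] [FiniteDimensional ℝ V]

/-- The Weyl group `W₀`: the subgroup of linear automorphisms of `V` generated by the
orthogonal reflections in the roots. -/
def weylGroup (R : RootSystemBase V) : Subgroup (V ≃ₗ[ℝ] V) :=
  Subgroup.closure {w : V ≃ₗ[ℝ] V | ∃ α ∈ R.roots, ∀ v, w v = sRefl α v}

/-- A strictly positive `W₀`-invariant multiplicity function. -/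
def IsMultiplicity (R : RootSystemBase V) (k : V → ℝ) : Prop :=
  (∀ α ∈ R.roots, 0 < k α) ∧
  (∀ w : V ≃ₗ[ℝ] V, w ∈ weylGroup R → ∀ α ∈ R.roots, k (w α) = k α)

/-- `σ_η^k = Σ_{α∈Σ₀} arctan(η(α∨)/k_α)·α`. -/
def sigmaFun (R : RootSystemBase V) (k : V → ℝ) (η : V) : V :=
  ∑ α ∈ R.roots, Real.arctan (⟪η, coroot α⟫ / k α) • α

/-- The master function
`S_k(μ,ξ) = ½‖ξ‖² − 2π⟨μ,ξ⟩ + ½ Σ_{α∈Σ₀} ‖α‖² ∫₀^{ξ(α∨)} arctan(t/k_α) dt`. -/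
def masterFun (R : RootSystemBase V) (k : V → ℝ) (μ ξ : V) : ℝ :=
  ‖ξ‖ ^ 2 / 2 - 2 * Real.pi * ⟪μ, ξ⟫ +
    (1 / 2) * ∑ α ∈ R.roots, ‖α‖ ^ 2 * ∫ t in (0:ℝ)..(⟪ξ, coroot α⟫), Real.arctan (t / k α)

/-- Membership in the weight lattice `P = {λ ∈ V* : λ(α∨) ∈ ℤ ∀α ∈ Σ₀}`. -/
def IsWeight (R : RootSystemBase V) (lam : V) : Prop :=
  ∀ α ∈ R.roots, ∃ m : ℤ, ⟪lam, coroot α⟫ = (m : ℝ)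

/-- `η ∈ V*` is a Bethe root: `λ = iη` solves the Bethe ansatz equations
`e^{(wλ)(φ∨)} = ∏_{α∈Σ₀⁺} ((wλ)(α∨) − k_α)/((wλ)(α∨) + k_α))^{α(φ∨)}` for all `w ∈ W₀`,
where `m α = α(φ∨) ∈ ℤ≥0`. -/
def IsBetheRoot (R : RootSystemBase V) (k : V → ℝ) (m : V → ℕ) (η : V) : Prop :=
  ∀ w : V ≃ₗ[ℝ] V, w ∈ weylGroup R →
    Complex.exp (Complex.I * (⟪w η, coroot R.hroot⟫ : ℝ)) =
      ∏ α ∈ R.pos,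
        ((Complex.I * (⟪w η, coroot α⟫ : ℝ) - (k α : ℂ)) /
         (Complex.I * (⟪w η, coroot α⟫ : ℝ) + (k α : ℂ))) ^ (m α)

end

noncomputable section

section WeylReflections

variable {V : Type*} [NormedAddCommGroup V] [InnerProductSpace ℝ V]

lemma inner_coroot_self {α : V} (h : α ≠ 0) : ⟪α, coroot α⟫ = 2 := by
  have : ‖α‖ ≠ 0 := norm_ne_zero_iff.mpr h
  simp only [coroot, inner_smul_right, real_inner_self_eq_norm_sq]
  field_simp

lemma coroot_neg (α : V) : coroot (-α) = -coroot α := by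
  simp [coroot]

lemma sRefl_eq (α v : V) : sRefl α v = v - ⟪v, coroot α⟫ • α := by
  simp only [sRefl, coroot, inner_smul_right, smul_smul, real_inner_comm α v]
  rw [mul_comm]

lemma sRefl_self {α : V} (h : α ≠ 0) : sRefl α α = -α := by
  rw [sRefl_eq, inner_coroot_self h, two_smul]
  abel

lemma sRefl_sRefl {α : V} (h : α ≠ 0) (v : V) : sRefl α (sRefl α v) = v := by
  simp only [sRefl, inner_sub_right, inner_smul_right, inner_coroot_self h]
  module

lemma inner_sRefl_sRefl {α : V} (h : α ≠ 0) (x y : V) :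
    ⟪sRefl α x, sRefl α y⟫ = ⟪x, y⟫ := by
  have : ‖α‖ ≠ 0 := norm_ne_zero_iff.mpr h
  simp only [sRefl, coroot, inner_sub_right, inner_sub_left, inner_smul_right, inner_smul_left,
    real_inner_self_eq_norm_sq, real_inner_comm α x, RCLike.conj_to_real]
  field_simp
  ring

/-- The reflection `sRefl α` as a linear automorphism. -/
def sReflEquiv (α : V) (h : α ≠ 0) : V ≃ₗ[ℝ] V :=
  LinearEquiv.ofInvolutive
    { toFun := sRefl α
      map_add' := fun x y => by simp only [sRefl, inner_add_right]; module
      map_smul' := fun c x => by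
        simp only [sRefl, inner_smul_right, RingHom.id_apply]; module }
    (sRefl_sRefl h)

@[simp]
lemma sReflEquiv_apply (α : V) (h : α ≠ 0) (v : V) : sReflEquiv α h v = sRefl α v := rfl

lemma coroot_map {w : V ≃ₗ[ℝ] V} (hw : ∀ x y, ⟪w x, w y⟫ = ⟪x, y⟫) (α : V) :
    coroot (w α) = w (coroot α) := by
  have : ‖w α‖ ^ 2 = ‖α‖ ^ 2 := by
    rw [← real_inner_self_eq_norm_sq, ← real_inner_self_eq_norm_sq, hw]
  simp [coroot, this]

end WeylReflections

namespace RootSystemBase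

variable {V : Type*} [NormedAddCommGroup V] [InnerProductSpace ℝ V] [FiniteDimensional ℝ V]
  (R : RootSystemBase V)

lemma sReflEquiv_mem {α : V} (hα : α ∈ R.roots) :
    sReflEquiv α (R.ne_zero α hα) ∈ weylGroup R :=
  Subgroup.subset_closure ⟨α, hα, fun _ => rfl⟩

lemma weyl_inner {w : V ≃ₗ[ℝ] V} (hw : w ∈ weylGroup R) (x y : V) :
    ⟪w x, w y⟫ = ⟪x, y⟫ := by
  induction hw using Subgroup.closure_induction generalizing x y with
  | mem w h =>
    obtain ⟨α, hα, h⟩ := h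
    rw [h, h, inner_sRefl_sRefl (R.ne_zero α hα)]
  | one => rfl
  | mul a b _ _ ha hb => rw [LinearEquiv.mul_apply, LinearEquiv.mul_apply, ha, hb]
  | inv a _ ha =>
    rw [← ha (a⁻¹ x), ← LinearEquiv.mul_apply, ← LinearEquiv.mul_apply, mul_inv_cancel]
    rfl

lemma weyl_map_mem {w : V ≃ₗ[ℝ] V} (hw : w ∈ weylGroup R) {α : V} (hα : α ∈ R.roots) :
    w α ∈ R.roots := by
  have key : ∀ v : V ≃ₗ[ℝ] V, v ∈ weylGroup R →
      (∀ β ∈ R.roots, v β ∈ R.roots) ∧ (∀ β ∈ R.roots, v⁻¹ β ∈ R.roots) := by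
    intro v hv
    induction hv using Subgroup.closure_induction with
    | mem v h =>
      obtain ⟨γ, hγ, h⟩ := h
      refine ⟨fun β hβ => h β ▸ R.refl_mem γ hγ β hβ, fun β hβ => ?_⟩
      have : v⁻¹ β = sRefl γ β := by
        apply v.injective
        rw [h (sRefl γ β), sRefl_sRefl (R.ne_zero γ hγ), ← LinearEquiv.mul_apply, mul_inv_cancel]
        rfl
      exact this ▸ R.refl_mem γ hγ β hβ
    | one => exact ⟨fun β hβ => hβ, fun β hβ => hβ⟩
    | mul a b _ _ ha hb =>
      refine ⟨fun β hβ => ha.1 _ (hb.1 β hβ), fun β hβ => ?_⟩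
      rw [mul_inv_rev]
      exact hb.2 _ (ha.2 β hβ)
    | inv a _ ha => exact ⟨ha.2, by simpa using ha.1⟩
  exact (key w hw).1 α hα

lemma neg_mem {α : V} (hα : α ∈ R.roots) : -α ∈ R.roots :=
  sRefl_self (R.ne_zero α hα) ▸ R.refl_mem α hα α hα

/-- Nonnegative combinations of simple roots. -/
def IsNonnegCombo (v : V) : Prop :=
  ∃ c : V → ℝ, (∀ β, 0 ≤ c β) ∧ v = ∑ β ∈ R.simples, c β • β

variable {R}

lemma IsNonnegCombo.add {u v : V} (hu : R.IsNonnegCombo u) (hv : R.IsNonnegCombo v) :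
    R.IsNonnegCombo (u + v) := by
  obtain ⟨c, hc, rfl⟩ := hu
  obtain ⟨d, hd, rfl⟩ := hv
  exact ⟨c + d, fun β => add_nonneg (hc β) (hd β), by
    simp [add_smul, Finset.sum_add_distrib]⟩

lemma IsNonnegCombo.smul {v : V} (hv : R.IsNonnegCombo v) {t : ℝ} (ht : 0 ≤ t) :
    R.IsNonnegCombo (t • v) := by
  obtain ⟨c, hc, rfl⟩ := hv
  exact ⟨fun β => t * c β, fun β => mul_nonneg ht (hc β), by
    simp [Finset.smul_sum, smul_smul]⟩

lemma IsNonnegCombo.eq_zero {v : V} (hv : R.IsNonnegCombo v) (hv' : R.IsNonnegCombo (-v)) :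
    v = 0 := by
  obtain ⟨c, hc, h⟩ := hv
  obtain ⟨d, hd, h'⟩ := hv'
  have hsum : ∑ β : {x // x ∈ R.simples}, (c β + d β) • (β : V) = 0 := by
    rw [Finset.sum_coe_sort R.simples (fun β => (c β + d β) • β)]
    simp only [add_smul, Finset.sum_add_distrib]
    rw [← h, ← h', add_neg_cancel]
  have hz := Fintype.linearIndependent_iff.mp R.simples_indep _ hsum
  rw [h]
  refine Finset.sum_eq_zero fun β hβ => ?_
  have h0 : c β = 0 := by linarith [hz ⟨β, hβ⟩, hc β, hd β]
  rw [h0, zero_smul]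

lemma isNonnegCombo_of_mem_pos {α : V} (hα : α ∈ R.pos) : R.IsNonnegCombo α :=
  R.pos_combo α hα

lemma mem_pos_of_isNonnegCombo {α : V} (hα : α ∈ R.roots) (h : R.IsNonnegCombo α) :
    α ∈ R.pos := by
  rcases R.pos_or_neg α hα with h' | h'
  · exact h'.1
  · exact absurd (h.eq_zero (isNonnegCombo_of_mem_pos h'.2)) (R.ne_zero α hα)

variable (R)

lemma hroot_mem : R.hroot ∈ R.roots := R.pos_sub R.hroot_pos

lemma hroot_ne_zero : R.hroot ≠ 0 := R.ne_zero _ R.hroot_mem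

/-- A positive root other than the highest root `φ` pairs to `0` or `1` with `φ∨`. -/
lemma inner_coroot_hroot {α : V} (hα : α ∈ R.pos) (hne : α ≠ R.hroot) :
    ⟪α, coroot R.hroot⟫ = 0 ∨ ⟪α, coroot R.hroot⟫ = 1 := by
  have hαR := R.pos_sub hα
  obtain ⟨m, hm⟩ := R.crystallographic R.hroot R.hroot_mem α hαR
  have hs : sRefl R.hroot α = α - (m : ℝ) • R.hroot := by rw [sRefl_eq, hm]
  have hmem := R.refl_mem _ R.hroot_mem α hαR
  have hφ := isNonnegCombo_of_mem_pos R.hroot_pos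
  have hlow : 0 ≤ m := by
    by_contra! hlt
    have hlt' : (m : ℝ) ≤ -1 := by exact_mod_cast (by omega : m ≤ -1)
    have h1 : R.IsNonnegCombo (R.hroot - sRefl R.hroot α) := R.hroot_highest _ hmem
    have h2 := h1.add (hφ.smul (show (0 : ℝ) ≤ -1 - m by linarith))
    have h3 : R.IsNonnegCombo (-α) := by
      convert h2 using 1
      rw [hs]
      module
    exact R.ne_zero α hαR ((isNonnegCombo_of_mem_pos hα).eq_zero h3)
  have hupp : m < 2 := by
    by_contra! hge
    have hge' : (2 : ℝ) ≤ m := by exact_mod_cast hge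
    have h1 : R.IsNonnegCombo (R.hroot - -sRefl R.hroot α) :=
      R.hroot_highest _ (R.neg_mem hmem)
    have h2 := h1.add (hφ.smul (show (0 : ℝ) ≤ m - 2 by linarith))
    have h3 : R.IsNonnegCombo (-(R.hroot - α)) := by
      convert h2 using 1
      rw [hs]
      module
    have h4 : R.IsNonnegCombo (R.hroot - α) := R.hroot_highest α hαR
    exact hne (sub_eq_zero.mp (h4.eq_zero h3)).symm
  rw [hm]
  have : m = 0 ∨ m = 1 := by omega
  rcases this with rfl | rfl <;> simp

lemma inner_coroot_hroot_self : ⟪R.hroot, coroot R.hroot⟫ = 2 :=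
  inner_coroot_self R.hroot_ne_zero

lemma one_le_inner_coroot_hroot {α : V} (hα : α ∈ R.pos) (h : ⟪α, coroot R.hroot⟫ ≠ 0) :
    1 ≤ ⟪α, coroot R.hroot⟫ := by
  by_cases hne : α = R.hroot
  · rw [hne, inner_coroot_hroot_self]
    norm_num
  · exact ((R.inner_coroot_hroot hα hne).resolve_left h).ge

lemma neg_sRefl_hroot_mem_pos {α : V} (hα : α ∈ R.pos) (h : ⟪α, coroot R.hroot⟫ ≠ 0) :
    -sRefl R.hroot α ∈ R.pos := by
  have h1 := R.one_le_inner_coroot_hroot hα h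
  refine mem_pos_of_isNonnegCombo
    (R.neg_mem (R.refl_mem _ R.hroot_mem _ (R.pos_sub hα))) ?_
  have h2 : R.IsNonnegCombo (R.hroot - α) := R.hroot_highest α (R.pos_sub hα)
  convert h2.add ((isNonnegCombo_of_mem_pos R.hroot_pos).smul (sub_nonneg.mpr h1)) using 1
  rw [sRefl_eq]
  module

lemma inner_neg_sRefl_hroot (α : V) :
    ⟪-sRefl R.hroot α, coroot R.hroot⟫ = ⟪α, coroot R.hroot⟫ := by
  rw [sRefl_eq, inner_neg_left, inner_sub_left, inner_smul_left, inner_coroot_hroot_self]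
  simp only [RCLike.conj_to_real]
  ring

lemma sRefl_hroot_neg_sRefl_hroot (α : V) :
    -sRefl R.hroot (-sRefl R.hroot α) = α := by
  have h := sRefl_sRefl R.hroot_ne_zero α
  rw [← sReflEquiv_apply _ R.hroot_ne_zero (-_), map_neg, sReflEquiv_apply, h, neg_neg]

/-- Only the positive roots not orthogonal to the highest root `φ` contribute to the difference
of a sum over positive roots and its `s_φ`-transform; `s_φ` sends these to their negatives. -/
lemma sum_pos_sub_sum_pos_sRefl {A : Type*} [AddCommGroup A] (f : V → A) :
    ∑ α ∈ R.pos, f α - ∑ α ∈ R.pos, f (sRefl R.hroot α) =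
      ∑ α ∈ R.pos with ⟪α, coroot R.hroot⟫ ≠ 0, (f α - f (-α)) := by
  classical
  rw [← Finset.sum_filter_add_sum_filter_not R.pos (fun α => ⟪α, coroot R.hroot⟫ ≠ 0) f,
    ← Finset.sum_filter_add_sum_filter_not R.pos (fun α => ⟪α, coroot R.hroot⟫ ≠ 0)
      (fun α => f (sRefl R.hroot α)), Finset.sum_sub_distrib]
  have h0 : ∑ α ∈ R.pos with ¬⟪α, coroot R.hroot⟫ ≠ 0, f (sRefl R.hroot α) =
      ∑ α ∈ R.pos with ¬⟪α, coroot R.hroot⟫ ≠ 0, f α := by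
    refine Finset.sum_congr rfl fun α hα => ?_
    rw [sRefl_eq, not_not.mp (Finset.mem_filter.mp hα).2, zero_smul, sub_zero]
  have h1 : ∑ α ∈ R.pos with ⟪α, coroot R.hroot⟫ ≠ 0, f (sRefl R.hroot α) =
      ∑ α ∈ R.pos with ⟪α, coroot R.hroot⟫ ≠ 0, f (-α) := by
    have hmap : ∀ α ∈ R.pos.filter (fun α => ⟪α, coroot R.hroot⟫ ≠ 0),
        -sRefl R.hroot α ∈ R.pos.filter (fun α => ⟪α, coroot R.hroot⟫ ≠ 0) := by
      intro α hα
      obtain ⟨h, h'⟩ := Finset.mem_filter.mp hα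
      exact Finset.mem_filter.mpr ⟨R.neg_sRefl_hroot_mem_pos h h', by
        rwa [R.inner_neg_sRefl_hroot]⟩
    exact Finset.sum_nbij' (fun α => -sRefl R.hroot α) (fun α => -sRefl R.hroot α) hmap hmap
      (fun α _ => R.sRefl_hroot_neg_sRefl_hroot α) (fun α _ => R.sRefl_hroot_neg_sRefl_hroot α)
      (fun α _ => by rw [neg_neg])
  rw [h0, h1]
  abel

lemma sum_roots_eq_two_mul_sum_pos (g : V → ℂ) (hg : ∀ α ∈ R.roots, g (-α) = g α) :
    ∑ α ∈ R.roots, g α = 2 * ∑ α ∈ R.pos, g α := by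
  classical
  have h1 : R.roots.filter (· ∈ R.pos) = R.pos := by
    ext α
    simpa using fun h => R.pos_sub h
  have h2 : ∑ α ∈ R.roots with α ∉ R.pos, g α = ∑ α ∈ R.pos, g α := by
    refine Finset.sum_nbij' (fun α => -α) (fun α => -α) ?_ ?_ (by simp) (by simp) ?_
    · intro α hα
      obtain ⟨h, h'⟩ := Finset.mem_filter.mp hα
      rcases R.pos_or_neg α h with h'' | h''
      · exact absurd h''.1 h'
      · exact h''.2
    · intro α hα
      refine Finset.mem_filter.mpr ⟨R.neg_mem (R.pos_sub hα), ?_⟩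
      rcases R.pos_or_neg α (R.pos_sub hα) with h'' | h''
      · exact h''.2
      · exact absurd hα h''.1
    · intro α hα
      exact (hg α (Finset.mem_filter.mp hα).1).symm
  rw [← Finset.sum_filter_add_sum_filter_not R.roots (· ∈ R.pos) g, h1, h2, two_mul]

lemma sum_roots_weyl {A : Type*} [AddCommMonoid A] (g : V → A) {w : V ≃ₗ[ℝ] V}
    (hw : w ∈ weylGroup R) : ∑ α ∈ R.roots, g (w α) = ∑ α ∈ R.roots, g α :=
  Finset.sum_nbij' w w.symm (fun _ hα => R.weyl_map_mem hw hα)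
    (fun _ hα => R.weyl_map_mem ((weylGroup R).inv_mem hw) hα)
    (fun α _ => w.symm_apply_apply α) (fun α _ => w.apply_symm_apply α) (fun _ _ => rfl)

end RootSystemBase

lemma IsMultiplicity.neg {V : Type*} [NormedAddCommGroup V] [InnerProductSpace ℝ V]
    [FiniteDimensional ℝ V] {R : RootSystemBase V} {k : V → ℝ} (hk : IsMultiplicity R k)
    {α : V} (hα : α ∈ R.roots) : k (-α) = k α := by
  have h := hk.2 _ (R.sReflEquiv_mem hα) α hα
  rwa [sReflEquiv_apply, sRefl_self (R.ne_zero α hα)] at h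

lemma ofReal_sq_add_sq_ne_zero {a : ℝ} (ha : 0 < a) (b : ℝ) : (a : ℂ) ^ 2 + (b : ℂ) ^ 2 ≠ 0 := by
  exact_mod_cast (by positivity : a ^ 2 + b ^ 2 ≠ 0)

lemma div_sub_neg_div_neg {a : ℝ} (ha : 0 < a) (b : ℝ) (c : ℂ) :
    c / (Complex.I * b + a) - -c / (Complex.I * (-b) + a) =
      2 * (a * c / ((a : ℂ) ^ 2 + (b : ℂ) ^ 2)) := by
  have h1 : Complex.I * b + a ≠ 0 := fun h => ha.ne' (by simpa using congrArg Complex.re h)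
  have h2 : Complex.I * (-b) + a ≠ 0 := fun h => ha.ne' (by simpa using congrArg Complex.re h)
  have h3 : (a : ℂ) ^ 2 + (b : ℂ) ^ 2 = (Complex.I * b + a) * (Complex.I * (-b) + a) := by
    linear_combination (b : ℂ) ^ 2 * Complex.I_sq
  rw [h3, div_sub_div _ _ h1 h2, ← mul_div_assoc]
  congr 1
  ring

/-- For `η ∈ V*`, `λ = iη` and `w ∈ W₀`, the identity
`K_λ^k(w⁻¹φ∨) = w⁻¹(ρ_{wλ}^k) − w⁻¹(s_φ(ρ_{s_φ(wλ)}^k))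
  + (((wλ)(φ∨)² − k_φ² − 2k_φ)/((wλ)(φ∨)² − k_φ²))·w⁻¹φ∨`
holds in `V_ℂ`, and the denominator `(wλ)(φ∨)² − k_φ²` is nonzero. Elements of `V_ℂ` are
identified with their ℂ-bilinear pairings against test vectors `ξ ∈ V` (via the inner
product); `w⁻¹` pairs as `⟨w⁻¹z, ξ⟩ = ⟨z, wξ⟩` and `s_φ` as `⟨s_φ z, ξ⟩ = ⟨z, s_φ ξ⟩`,
since `w` and `s_φ` are orthogonal. Here
`ρ_ν^k = Σ_{α∈Σ₀⁺} α∨/(ν(α∨)+k_α)`, `(wλ)(x) = i⟨wη, x⟩`, and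
`K_λ^k(v) = v + Σ_{α∈Σ₀} k_α α(v) α∨/(k_α² − λ(α∨)²)`,
whose denominators are `k_α² + η(α∨)² > 0`. -/
theorem statement10
    {V : Type*} [NormedAddCommGroup V] [InnerProductSpace ℝ V] [FiniteDimensional ℝ V]
    (R : RootSystemBase V) (k : V → ℝ) (hk : IsMultiplicity R k)
    (η : V) (w : V ≃ₗ[ℝ] V) (hw : w ∈ weylGroup R) :
    ((Complex.I * (⟪w η, coroot R.hroot⟫ : ℝ)) ^ 2 - ((k R.hroot : ℂ)) ^ 2) ≠ 0 ∧
    ∀ ξ : V,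
      ((⟪w.symm (coroot R.hroot), ξ⟫ : ℝ) : ℂ) +
        ∑ α ∈ R.roots,
          ((k α * ⟪α, w.symm (coroot R.hroot)⟫ * ⟪coroot α, ξ⟫ /
              ((k α) ^ 2 + (⟪η, coroot α⟫ : ℝ) ^ 2) : ℝ) : ℂ)
      =
      (∑ α ∈ R.pos, ((⟪coroot α, w ξ⟫ : ℝ) : ℂ) /
          (Complex.I * (⟪w η, coroot α⟫ : ℝ) + (k α : ℂ)))
      - (∑ α ∈ R.pos, ((⟪coroot α, sRefl R.hroot (w ξ)⟫ : ℝ) : ℂ) /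
          (Complex.I * (⟪w η, sRefl R.hroot (coroot α)⟫ : ℝ) + (k α : ℂ)))
      + (((Complex.I * (⟪w η, coroot R.hroot⟫ : ℝ)) ^ 2 - (k R.hroot : ℂ) ^ 2
            - 2 * (k R.hroot : ℂ)) /
          ((Complex.I * (⟪w η, coroot R.hroot⟫ : ℝ)) ^ 2 - (k R.hroot : ℂ) ^ 2)) *
        ((⟪w.symm (coroot R.hroot), ξ⟫ : ℝ) : ℂ) := by
  have hφ := R.hroot_mem
  have hkφ := hk.1 _ hφ
  set φ := R.hroot with hφ_def
  have hD : (Complex.I * (⟪w η, coroot φ⟫ : ℝ)) ^ 2 - (k φ : ℂ) ^ 2 =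
      -((k φ : ℂ) ^ 2 + ((⟪w η, coroot φ⟫ : ℝ) : ℂ) ^ 2) := by
    linear_combination ((⟪w η, coroot φ⟫ : ℝ) : ℂ) ^ 2 * Complex.I_sq
  have hE := ofReal_sq_add_sq_ne_zero hkφ ⟪w η, coroot φ⟫
  rw [hD]
  refine ⟨neg_ne_zero.mpr hE, fun ξ => ?_⟩
  have hsymm : ∀ x y : V, ⟪x, w.symm y⟫ = ⟪w x, y⟫ := fun x y => by
    rw [← R.weyl_inner hw, w.apply_symm_apply]
  let f : V → ℂ := fun α =>
    ((⟪coroot α, w ξ⟫ : ℝ) : ℂ) / (Complex.I * (⟪w η, coroot α⟫ : ℝ) + (k α : ℂ))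
  let T : V → ℂ := fun α =>
    k α * ((⟪coroot α, w ξ⟫ : ℝ) : ℂ) / ((k α : ℂ) ^ 2 + ((⟪w η, coroot α⟫ : ℝ) : ℂ) ^ 2)
  let g : V → ℂ := fun α => ((⟪α, coroot φ⟫ : ℝ) : ℂ) * T α
  have hs := R.sReflEquiv_mem hφ
  have hK : ∑ α ∈ R.roots,
      ((k α * ⟪α, w.symm (coroot φ)⟫ * ⟪coroot α, ξ⟫ /
        ((k α) ^ 2 + (⟪η, coroot α⟫ : ℝ) ^ 2) : ℝ) : ℂ) = 2 * ∑ α ∈ R.pos, g α := by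
    rw [← R.sum_roots_eq_two_mul_sum_pos g, ← R.sum_roots_weyl g hw]
    · refine Finset.sum_congr rfl fun α hα => ?_
      simp only [g, T]
      rw [coroot_map (R.weyl_inner hw), R.weyl_inner hw, R.weyl_inner hw, hk.2 w hw α hα, hsymm]
      push_cast
      ring
    · intro α hα
      simp only [g, T, coroot_neg, inner_neg_left, inner_neg_right, hk.neg hα]
      push_cast
      ring
  have hρ : ∑ α ∈ R.pos, ((⟪coroot α, sRefl φ (w ξ)⟫ : ℝ) : ℂ) /
      (Complex.I * (⟪w η, sRefl φ (coroot α)⟫ : ℝ) + (k α : ℂ)) =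
      ∑ α ∈ R.pos, f (sRefl φ α) := by
    refine Finset.sum_congr rfl fun α hα => ?_
    simp only [f]
    have hcor : coroot (sRefl φ α) = sRefl φ (coroot α) := coroot_map (R.weyl_inner hs) α
    have hkα : k (sRefl φ α) = k α := hk.2 _ hs α (R.pos_sub hα)
    rw [hcor, hkα, ← inner_sRefl_sRefl R.hroot_ne_zero (sRefl φ _) (w ξ),
      sRefl_sRefl R.hroot_ne_zero]
  have hf : ∀ α ∈ R.pos, f α - f (-α) = 2 * T α := by
    intro α hα
    have h := div_sub_neg_div_neg (hk.1 α (R.pos_sub hα)) ⟪w η, coroot α⟫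
      ((⟪coroot α, w ξ⟫ : ℝ) : ℂ)
    simp only [f, T, coroot_neg, inner_neg_left, inner_neg_right, hk.neg (R.pos_sub hα)]
    push_cast
    exact h
  have hdiff : 2 * ∑ α ∈ R.pos, g α -
      ∑ α ∈ R.pos with ⟪α, coroot φ⟫ ≠ 0, (f α - f (-α)) = 2 * T φ := by
    rw [Finset.sum_filter, Finset.mul_sum, ← Finset.sum_sub_distrib,
      Finset.sum_eq_single_of_mem φ R.hroot_pos]
    · rw [if_pos (by rw [R.inner_coroot_hroot_self]; norm_num), hf φ R.hroot_pos]
      simp only [g]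
      rw [R.inner_coroot_hroot_self]
      push_cast
      ring
    · intro α hα hne
      rcases R.inner_coroot_hroot hα hne with h | h
      · simp [g, φ, h]
      · rw [if_pos (by rw [h]; norm_num), hf α hα]
        simp only [g]
        rw [h]
        push_cast
        ring
  have hφξ : ⟪w.symm (coroot φ), ξ⟫ = ⟪coroot φ, w ξ⟫ := by
    rw [real_inner_comm, hsymm, real_inner_comm]
  have hC : (-((k φ : ℂ) ^ 2 + ((⟪w η, coroot φ⟫ : ℝ) : ℂ) ^ 2) - 2 * (k φ : ℂ)) /
      -((k φ : ℂ) ^ 2 + ((⟪w η, coroot φ⟫ : ℝ) : ℂ) ^ 2) * ((⟪coroot φ, w ξ⟫ : ℝ) : ℂ) =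
      ((⟪coroot φ, w ξ⟫ : ℝ) : ℂ) + 2 * T φ := by
    simp only [T]
    field_simp
    ring
  rw [hK, hρ, hφξ, hC]
  linear_combination hdiff - R.sum_pos_sub_sum_pos_sRefl f

end
end

section
/- Let a = (α,m) be an affine root and let f : V → ℂ be continuous. Then the function g(v) = ∫₀^{α(v)+m} f(v − tα∨) dt is differentiable in the direction α∨ at every v ∈ V, with directional derivative (∂_{α∨} g)(v) = f(v) + f(s_a(v)). -/
open scoped BigOperators
open RealInnerProductSpace

noncomputable section

theorem inner_coroot_self_s11 {V : Type*} [NormedAddCommGroup V] [InnerProductSpace ℝ V]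
    {α : V} (hα : α ≠ 0) : ⟪α, coroot α⟫ = 2 := by
  have h : ‖α‖ ≠ 0 := norm_ne_zero_iff.mpr hα
  rw [coroot, real_inner_smul_right, real_inner_self_eq_norm_sq]
  field_simp

/-- The derivative at `0` of an integral of a continuous function over the interval
`[-(c + s), s]` moving outwards at unit speed at both ends. -/
theorem hasDerivAt_integral_neg_add {E : Type*} [NormedAddCommGroup E] [NormedSpace ℝ E]
    [CompleteSpace E] {F : ℝ → E} (hF : Continuous F) (c : ℝ) :
    HasDerivAt (fun s : ℝ => ∫ u in (-(c + s))..s, F u) (F 0 + F (-c)) 0 := by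
  have hright : HasDerivAt (fun s : ℝ => ∫ u in (0:ℝ)..s, F u) (F 0) 0 :=
    (hF.integral_hasStrictDerivAt 0 0).hasDerivAt
  have hend : HasDerivAt (fun s : ℝ => -(c + s)) (-1) 0 :=
    ((hasDerivAt_id (0:ℝ)).const_add c).neg
  have houter : HasDerivAt (fun s : ℝ => ∫ u in (0:ℝ)..s, F u) (F (-c)) (-(c + 0)) := by
    simpa using (hF.integral_hasStrictDerivAt 0 (-(c + 0))).hasDerivAt
  have hleft := houter.scomp (0:ℝ) hend
  convert hright.sub hleft using 1
  · funext s
    exact (intervalIntegral.integral_interval_sub_left (hF.intervalIntegrable _ _)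
      (hF.intervalIntegrable _ _)).symm
  · simp

/-- For an affine root `a = (α,m)` and continuous `f : V → ℂ`, the
function `g(v) = ∫₀^{α(v)+m} f(v − tα∨) dt` is differentiable in the direction `α∨` at
every `v`, with `(∂_{α∨}g)(v) = f(v) + f(s_a(v))`. -/
theorem statement11
    {V : Type*} [NormedAddCommGroup V] [InnerProductSpace ℝ V] [FiniteDimensional ℝ V]
    (R : RootSystemBase V)
    (α : V) (hα : α ∈ R.roots) (mm : ℤ) (f : V → ℂ) (hf : Continuous f) (v : V) :
    HasDerivAt
      (fun s : ℝ => ∫ t in (0:ℝ)..(⟪α, v + s • coroot α⟫ + (mm : ℝ)),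
        f ((v + s • coroot α) - t • coroot α))
      (f v + f (v - (⟪α, v⟫ + (mm : ℝ)) • coroot α)) 0 := by
  have hF : Continuous fun u : ℝ => f (v + u • coroot α) := by fun_prop
  have hderiv := hasDerivAt_integral_neg_add hF (⟪α, v⟫ + (mm : ℝ))
  simp only [zero_smul, add_zero, neg_smul, ← sub_eq_add_neg] at hderiv
  refine hderiv.congr_of_eventuallyEq (.of_forall fun s => ?_)
  have hsub := intervalIntegral.integral_comp_sub_left
    (a := 0) (b := ⟪α, v + s • coroot α⟫ + (mm : ℝ)) (fun u : ℝ => f (v + u • coroot α)) s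
  have hlow : s - (⟪α, v + s • coroot α⟫ + (mm : ℝ)) = -(⟪α, v⟫ + (mm : ℝ) + s) := by
    rw [inner_add_right, real_inner_smul_right, inner_coroot_self_s11 (R.ne_zero α hα)]
    ring
  rw [hlow, sub_zero] at hsub
  simpa only [sub_smul, ← add_sub_assoc] using hsub

end
end

section
/- Let λ ∈ V*_ℂ and for each μ in the (finite) Weyl group orbit W₀λ ⊂ V*_ℂ let p_μ : V → ℂ be a polynomial function. Set f(v) = Σ_{μ∈W₀λ} p_μ(v)·e^{μ(v)}. If f is invariant under translation by the coroot lattice, i.e. f(v + γ) = f(v) for all v ∈ V and all γ ∈ Q∨ = ℤ-span{α∨ : α ∈ Σ₀}, then every p_μ is a constant function; and if moreover f is not identically zero, then λ ∈ 2πi·P, i.e. λ(α∨) ∈ 2πi·ℤ for all α ∈ Σ₀. -/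
open scoped BigOperators
open RealInnerProductSpace

noncomputable section

/-- A polynomial function `V → ℂ`: an element of the subalgebra of `V → ℂ` generated by
the (ℂ-valued extensions of) ℝ-linear functionals on `V`. -/
def IsPolynomialFun {V : Type*} [NormedAddCommGroup V] [InnerProductSpace ℝ V]
    (p : V → ℂ) : Prop :=
  p ∈ Algebra.adjoin ℂ {q : V → ℂ | ∃ l : V →ₗ[ℝ] ℝ, ∀ v, q v = ((l v : ℝ) : ℂ)}

/-- The Weyl group preserves the coroot lattice. -/
lemma weylGroup_apply_mem_corootLattice
    {V : Type*} [NormedAddCommGroup V] [InnerProductSpace ℝ V] [FiniteDimensional ℝ V]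
    (R : RootSystemBase V) {w : V ≃ₗ[ℝ] V} (hw : w ∈ weylGroup R) (x : V) :
    w x ∈ Submodule.span ℤ ((fun α => coroot α) '' (R.roots : Set V)) ↔
      x ∈ Submodule.span ℤ ((fun α => coroot α) '' (R.roots : Set V)) := by
  unfold weylGroup at hw
  induction hw using Subgroup.closure_induction generalizing x with
  | mem w hw =>
    obtain ⟨α, hα, hw⟩ := hw
    have key : ∀ y ∈ Submodule.span ℤ ((fun α => coroot α) '' (R.roots : Set V)),
        sRefl α y ∈ Submodule.span ℤ ((fun α => coroot α) '' (R.roots : Set V)) := by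
      intro y hy
      have hint : ∃ m : ℤ, ⟪α, y⟫ = (m : ℝ) := by
        induction hy using Submodule.span_induction with
        | mem y hy =>
          obtain ⟨β, hβ, rfl⟩ := hy
          exact R.crystallographic β hβ α hα
        | zero => exact ⟨0, by simp⟩
        | add y z _ _ hy hz =>
          obtain ⟨a, ha⟩ := hy
          obtain ⟨b, hb⟩ := hz
          exact ⟨a + b, by rw [inner_add_right, ha, hb]; push_cast; rfl⟩
        | smul c y _ hy =>
          obtain ⟨a, ha⟩ := hy
          exact ⟨c * a, by
            rw [← Int.cast_smul_eq_zsmul ℝ, inner_smul_right, ha]; push_cast; rfl⟩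
      obtain ⟨m, hm⟩ := hint
      rw [sRefl, hm, Int.cast_smul_eq_zsmul]
      exact Submodule.sub_mem _ hy
        (Submodule.smul_mem _ _ (Submodule.subset_span ⟨α, hα, rfl⟩))
    have hinvol : sRefl α (sRefl α x) = x := by
      have hne : ‖α‖ ≠ 0 := norm_ne_zero_iff.mpr (R.ne_zero α hα)
      have h2 : ⟪α, coroot α⟫ = 2 := by
        rw [coroot, inner_smul_right, real_inner_self_eq_norm_sq]
        field_simp
      have h3 : ⟪α, sRefl α x⟫ = -⟪α, x⟫ := by
        rw [sRefl, inner_sub_right, inner_smul_right, h2]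
        ring
      rw [sRefl, h3, sRefl]
      simp
    rw [hw]
    exact ⟨fun h => hinvol ▸ key _ h, key x⟩
  | one => rfl
  | mul a b _ _ ha hb => exact (ha (b x)).trans (hb x)
  | inv a _ ha =>
    have : a (a⁻¹ x) = x := a.apply_symm_apply x
    rw [← ha, this]

/-- Translation by `u` as an operator on functions. -/
def translation {G : Type*} [AddCommGroup G] (u : G) : Module.End ℂ (G → ℂ) :=
  LinearMap.funLeft ℂ ℂ (fun v => v + u)

@[simp] lemma translation_apply {G : Type*} [AddCommGroup G] (u : G) (g : G → ℂ) (v : G) :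
    translation u g v = g (v + u) := rfl

lemma commute_translation {G : Type*} [AddCommGroup G] (u v : G) : Commute (translation u) (translation v) := by
  refine LinearMap.ext fun g => funext fun x => ?_
  simp [add_right_comm]

section ExponentialPolynomials

variable {V : Type*} [NormedAddCommGroup V] [InnerProductSpace ℝ V]

/-- A polynomial function restricts to a polynomial on all lines in a given direction, with
uniformly bounded degree. -/
lemma IsPolynomialFun.exists_polynomial {p : V → ℂ} (hp : IsPolynomialFun p) (u : V) :
    ∃ N : ℕ, ∀ v : V, ∃ P : Polynomial ℂ, P.natDegree ≤ N ∧
      ∀ t : ℝ, p (v + t • u) = P.eval (t : ℂ) := by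
  unfold IsPolynomialFun at hp
  induction hp using Algebra.adjoin_induction with
  | mem q hq =>
    obtain ⟨l, hl⟩ := hq
    refine ⟨1, fun v => ⟨Polynomial.C ((l u : ℝ) : ℂ) * Polynomial.X +
      Polynomial.C ((l v : ℝ) : ℂ), Polynomial.natDegree_linear_le, fun t => ?_⟩⟩
    rw [hl, map_add, map_smul, smul_eq_mul, Polynomial.eval_add, Polynomial.eval_mul,
      Polynomial.eval_C, Polynomial.eval_C, Polynomial.eval_X]
    push_cast
    ring
  | algebraMap r =>
    exact ⟨0, fun v => ⟨Polynomial.C r, (Polynomial.natDegree_C r).le, fun t =>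
      (Polynomial.eval_C (a := r)).symm⟩⟩
  | add p q _ _ hp hq =>
    obtain ⟨M, hM⟩ := hp
    obtain ⟨N, hN⟩ := hq
    refine ⟨max M N, fun v => ?_⟩
    obtain ⟨P, hP, hP'⟩ := hM v
    obtain ⟨Q, hQ, hQ'⟩ := hN v
    exact ⟨P + Q, Polynomial.natDegree_add_le_of_le hP hQ, fun t => by simp [hP', hQ']⟩
  | mul p q _ _ hp hq =>
    obtain ⟨M, hM⟩ := hp
    obtain ⟨N, hN⟩ := hq
    refine ⟨M + N, fun v => ?_⟩
    obtain ⟨P, hP, hP'⟩ := hM v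
    obtain ⟨Q, hQ, hQ'⟩ := hN v
    exact ⟨P * Q, Polynomial.natDegree_mul_le_of_le hP hQ, fun t => by simp [hP', hQ']⟩

lemma IsPolynomialFun.exists_fwdDiff_iter_eq_zero {p : V → ℂ} (hp : IsPolynomialFun p) (u : V) :
    ∃ N : ℕ, (fwdDiff u)^[N] p = 0 := by
  obtain ⟨N, hN⟩ := hp.exists_polynomial u
  refine ⟨N + 1, funext fun v => ?_⟩
  obtain ⟨P, hP, hP'⟩ := hN v
  have h := congrFun (P.fwdDiff_iter_eq_zero_of_degree_lt (Nat.lt_succ_of_le hP)) 0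
  rw [fwdDiff_iter_eq_sum_shift] at h ⊢
  rw [Pi.zero_apply] at h ⊢
  rw [← h]
  refine Finset.sum_congr rfl fun k _ => ?_
  have := hP' k
  rw [Nat.cast_smul_eq_nsmul] at this
  rw [this]
  simp

/-- A polynomial function that is periodic in the direction `u` is constant along `u`. -/
lemma IsPolynomialFun.apply_add_smul_of_periodic {p : V → ℂ} (hp : IsPolynomialFun p) {u : V}
    (hu : ∀ v, p (v + u) = p v) (t : ℝ) (v : V) : p (v + t • u) = p v := by
  obtain ⟨N, hN⟩ := hp.exists_polynomial u
  obtain ⟨P, -, hP⟩ := hN v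
  have hper : ∀ k : ℕ, p (v + (k : ℝ) • u) = p v := by
    intro k
    induction k with
    | zero => simp
    | succ k ih => rw [← ih, ← hu (v + (k : ℝ) • u)]; push_cast; congr 1; module
  have hPC : P = .C (p v) := by
    refine Polynomial.eq_of_infinite_eval_eq _ _
      ((Set.infinite_range_of_injective (Nat.cast_injective (R := ℂ))).mono ?_)
    rintro _ ⟨k, rfl⟩
    have := hP k
    rw [hper k] at this
    simpa using this.symm
  rw [hP, hPC, Polynomial.eval_C]

lemma translation_sub_pow_apply (μ : V →ₗ[ℝ] ℂ) (u : V) (N : ℕ) (p : V → ℂ) (v : V) :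
    ((translation u - Complex.exp (μ u) • (1 : Module.End ℂ (V → ℂ))) ^ N)
      (fun v => p v * Complex.exp (μ v)) v =
      Complex.exp (μ u) ^ N * (fwdDiff u)^[N] p v * Complex.exp (μ v) := by
  induction N generalizing v with
  | zero => simp
  | succ N ih =>
    rw [pow_succ', Module.End.mul_apply]
    simp only [LinearMap.sub_apply, LinearMap.smul_apply, Module.End.one_apply, Pi.sub_apply,
      Pi.smul_apply, translation_apply, ih, Function.iterate_succ_apply', fwdDiff, map_add,
      Complex.exp_add, smul_eq_mul]
    ring

lemma IsPolynomialFun.mul_exp_mem_maxGenEigenspace {p : V → ℂ} (hp : IsPolynomialFun p)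
    (μ : V →ₗ[ℝ] ℂ) (u : V) :
    (fun v => p v * Complex.exp (μ v)) ∈
      (translation u).maxGenEigenspace (Complex.exp (μ u)) := by
  obtain ⟨N, hN⟩ := hp.exists_fwdDiff_iter_eq_zero u
  rw [Module.End.mem_maxGenEigenspace]
  exact ⟨N, funext fun v => by simp [translation_sub_pow_apply, hN]⟩

/-- An `ℝ`-linear functional is determined by its exponential. -/
lemma exp_comp_linearMap_injective :
    Function.Injective fun (μ : V →ₗ[ℝ] ℂ) (u : V) => Complex.exp (μ u) := by
  intro μ ν h
  refine LinearMap.ext fun u => ?_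
  have hd : ∀ ξ : V →ₗ[ℝ] ℂ,
      HasDerivAt (fun t : ℝ => Complex.exp (ξ (t • u))) (ξ u) 0 := by
    intro ξ
    have := ((Complex.ofRealCLM.hasDerivAt (x := (0 : ℝ))).mul_const (ξ u)).cexp
    simpa using this
  have h2 : (fun t : ℝ => Complex.exp (μ (t • u))) = fun t : ℝ => Complex.exp (ν (t • u)) :=
    funext fun t => congrFun h (t • u)
  exact (hd μ).unique (h2 ▸ hd ν)

/-- Functions in the joint generalized eigenspaces of all translations, for the characters
`exp ∘ μ` of distinct functionals `μ`, are linearly independent. -/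
lemma iSupIndep_translation_maxGenEigenspace :
    iSupIndep fun μ : V →ₗ[ℝ] ℂ =>
      ⨅ u : V, (translation u).maxGenEigenspace (Complex.exp (μ u)) := by
  have h := Module.End.independent_iInf_maxGenEigenspace_of_forall_mapsTo
    (fun u : V => translation u)
    fun u v φ => Module.End.mapsTo_maxGenEigenspace_of_comm (commute_translation v u) φ
  exact h.comp exp_comp_linearMap_injective

/-- Every summand of a translation-invariant exponential polynomial is translation invariant. -/
lemma exp_polynomial_summand_translation_eq {O : Finset (V →ₗ[ℝ] ℂ)}
    {p : (V →ₗ[ℝ] ℂ) → V → ℂ} (hp : ∀ μ ∈ O, IsPolynomialFun (p μ)) {γ : V}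
    (h : ∀ v, ∑ μ ∈ O, p μ (v + γ) * Complex.exp (μ (v + γ)) =
      ∑ μ ∈ O, p μ v * Complex.exp (μ v)) {μ : V →ₗ[ℝ] ℂ} (hμ : μ ∈ O) (v : V) :
    p μ (v + γ) * Complex.exp (μ (v + γ)) = p μ v * Complex.exp (μ v) := by
  have key := (iSupIndep_iff_finsetSum_eq_zero_imp_eq_zero _).mp
    (iSupIndep_translation_maxGenEigenspace (V := V)) O
    (fun μ => translation γ (fun v => p μ v * Complex.exp (μ v)) -
      fun v => p μ v * Complex.exp (μ v))
    (fun μ hμ => (Submodule.mem_iInf _).mpr fun u => by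
      have hm := (hp μ hμ).mul_exp_mem_maxGenEigenspace μ u
      exact Submodule.sub_mem _
        (Module.End.mapsTo_maxGenEigenspace_of_comm (commute_translation u γ) _ hm) hm)
    (funext fun v => by
      simpa [Finset.sum_apply, Finset.sum_sub_distrib, sub_eq_zero] using h v)
    μ hμ
  exact sub_eq_zero.mp (congrFun key v)

/-- If a nonzero exponential monomial is `γ`-invariant, then its exponent is trivial on `γ`. -/
lemma IsPolynomialFun.exp_eq_one_of_periodic {p : V → ℂ} (hp : IsPolynomialFun p)
    {μ : V →ₗ[ℝ] ℂ} {γ : V}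
    (h : ∀ v, p (v + γ) * Complex.exp (μ (v + γ)) = p v * Complex.exp (μ v))
    (hne : ∃ v, p v ≠ 0) : Complex.exp (μ γ) = 1 := by
  by_contra hexp
  obtain ⟨v, hv⟩ := hne
  have h1 : (fun v => p v * Complex.exp (μ v)) ∈ (translation γ).maxGenEigenspace 1 := by
    rw [Module.End.mem_maxGenEigenspace]
    exact ⟨1, funext fun v => by simpa [sub_eq_zero] using h v⟩
  have h0 := Submodule.disjoint_def.mp
    (Module.End.disjoint_genEigenspace (translation γ) hexp ⊤ ⊤) _
    (hp.mul_exp_mem_maxGenEigenspace μ γ) h1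
  exact mul_ne_zero hv (Complex.exp_ne_zero _) (congrFun h0 v)

end ExponentialPolynomials

/-- The coroots span the ambient space. -/
lemma span_coroot_eq_top
    {V : Type*} [NormedAddCommGroup V] [InnerProductSpace ℝ V] [FiniteDimensional ℝ V]
    (R : RootSystemBase V) :
    Submodule.span ℝ ((fun α => coroot α) '' (R.roots : Set V)) = ⊤ := by
  rw [eq_top_iff, ← R.spanning, Submodule.span_le]
  intro α hα
  have hne : ‖α‖ ≠ 0 := norm_ne_zero_iff.mpr (R.ne_zero α hα)
  have : α = (‖α‖ ^ 2 / 2) • coroot α := by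
    rw [coroot, smul_smul, show ‖α‖ ^ 2 / 2 * (2 / ‖α‖ ^ 2) = 1 by field_simp, one_smul]
  rw [SetLike.mem_coe, this]
  exact Submodule.smul_mem _ _ (Submodule.subset_span ⟨α, hα, rfl⟩)

/-- Let `λ ∈ V*_ℂ` (modelled as an ℝ-linear map `V → ℂ`), let `O` be
its (finite) `W₀`-orbit, and let `f(v) = Σ_{μ∈O} p_μ(v) e^{μ(v)}` with each `p_μ`
polynomial. If `f` is invariant under translations by the coroot lattice `Q∨`, then every
`p_μ` is constant, and if moreover `f ≢ 0` then `λ(α∨) ∈ 2πiℤ` for all `α ∈ Σ₀`. -/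
theorem statement13
    {V : Type*} [NormedAddCommGroup V] [InnerProductSpace ℝ V] [FiniteDimensional ℝ V]
    (R : RootSystemBase V) (lam : V →ₗ[ℝ] ℂ)
    (O : Finset (V →ₗ[ℝ] ℂ))
    (hO : ∀ μ : V →ₗ[ℝ] ℂ, μ ∈ O ↔
      ∃ w : V ≃ₗ[ℝ] V, w ∈ weylGroup R ∧ μ = lam.comp (w.symm.toLinearMap))
    (p : (V →ₗ[ℝ] ℂ) → V → ℂ) (hp : ∀ μ ∈ O, IsPolynomialFun (p μ))
    (f : V → ℂ) (hf : ∀ v : V, f v = ∑ μ ∈ O, p μ v * Complex.exp (μ v))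
    (hinv : ∀ v : V, ∀ γ ∈ Submodule.span ℤ ((fun α => coroot α) '' (R.roots : Set V)),
      f (v + γ) = f v) :
    (∀ μ ∈ O, ∃ c : ℂ, ∀ v : V, p μ v = c) ∧
    ((∃ v : V, f v ≠ 0) → ∀ α ∈ R.roots,
      ∃ j : ℤ, lam (coroot α) = 2 * Real.pi * Complex.I * (j : ℂ)) := by
  have hinv' : ∀ γ ∈ Submodule.span ℤ ((fun α => coroot α) '' (R.roots : Set V)),
      ∀ μ ∈ O, ∀ v, p μ (v + γ) * Complex.exp (μ (v + γ)) = p μ v * Complex.exp (μ v) :=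
    fun γ hγ μ hμ v => exp_polynomial_summand_translation_eq hp
      (fun v => by rw [← hf, ← hf, hinv v γ hγ]) hμ v
  refine ⟨fun μ hμ => ?_, ?_⟩
  · by_cases hne : ∃ v, p μ v ≠ 0
    · have hconst : ∀ u ∈ Submodule.span ℝ ((fun α => coroot α) '' (R.roots : Set V)),
          ∀ v, p μ (v + u) = p μ v := by
        intro u hu
        induction hu using Submodule.span_induction with
        | mem u hu =>
          intro v
          have hinvu := hinv' u (Submodule.subset_span hu) μ hμ
          have h := hinvu v
          rw [map_add, Complex.exp_add, (hp μ hμ).exp_eq_one_of_periodic hinvu hne, mul_one] at h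
          exact mul_right_cancel₀ (Complex.exp_ne_zero _) h
        | zero => simp
        | add a b _ _ ha hb => intro v; rw [← add_assoc, hb, ha]
        | smul c a _ ha => exact (hp μ hμ).apply_add_smul_of_periodic ha c
      refine ⟨p μ 0, fun v => ?_⟩
      simpa using hconst v (span_coroot_eq_top R ▸ Submodule.mem_top) 0
    · push Not at hne
      exact ⟨0, hne⟩
  · rintro ⟨v, hv⟩ α hα
    rw [hf] at hv
    obtain ⟨μ, hμ, hne⟩ := Finset.exists_ne_zero_of_sum_ne_zero hv
    obtain ⟨w, hw, rfl⟩ := (hO μ).mp hμ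
    have hmem := (weylGroup_apply_mem_corootLattice R hw (coroot α)).mpr
      (Submodule.subset_span ⟨α, hα, rfl⟩)
    have hexp := (hp _ hμ).exp_eq_one_of_periodic (hinv' _ hmem _ hμ)
      ⟨v, left_ne_zero_of_mul hne⟩
    obtain ⟨n, hn⟩ := Complex.exp_eq_one_iff.mp hexp
    refine ⟨n, ?_⟩
    simp only [LinearMap.comp_apply, LinearEquiv.coe_coe, LinearEquiv.symm_apply_apply] at hn
    rw [hn, mul_comm]

end
end

section
/- Let λ ∈ V*_ℂ satisfy Re(λ(α∨)) ≥ 0 for all α ∈ Σ₀⁺. If exp(λ(φ∨)) = ∏_{α∈Σ₀⁺} ((λ(α∨) − k_α)/(λ(α∨) + k_α))^{α(φ∨)} (all denominators are nonzero since Re(λ(α∨)) ≥ 0 and k_α > 0), then λ is purely imaginary, i.e. Re(λ(α∨)) = 0 for all α ∈ Σ₀, so λ ∈ iV*. -/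
open scoped BigOperators
open RealInnerProductSpace

noncomputable section

/-- The Cayley transform maps the closed right half plane into the closed unit disc. -/
theorem norm_sub_div_add_ofReal_le_one {z : ℂ} {k : ℝ} (hz : 0 ≤ z.re) (hk : 0 < k) :
    ‖(z - (k : ℂ)) / (z + (k : ℂ))‖ ≤ 1 := by
  rw [norm_div]
  refine div_le_one_of_le₀ ?_ (norm_nonneg _)
  rw [← sq_le_sq₀ (norm_nonneg _) (norm_nonneg _), Complex.sq_norm, Complex.sq_norm,
    Complex.normSq_apply, Complex.normSq_apply]
  simp only [Complex.sub_re, Complex.sub_im, Complex.add_re, Complex.add_im, Complex.ofReal_re,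
    Complex.ofReal_im]
  nlinarith [mul_nonneg hz hk.le]

theorem re_map_coroot {V : Type*} [NormedAddCommGroup V] [InnerProductSpace ℝ V]
    (lam : V →ₗ[ℝ] ℂ) (α : V) :
    (lam (coroot α)).re = 2 / ‖α‖ ^ 2 * (lam α).re := by
  rw [coroot, map_smul, Complex.smul_re, smul_eq_mul]

theorem re_map_sum_smul_nonneg {V : Type*} [NormedAddCommGroup V] [InnerProductSpace ℝ V]
    (lam : V →ₗ[ℝ] ℂ) {s : Finset V} {c : V → ℝ} (hc : ∀ β, 0 ≤ c β)
    (hs : ∀ β ∈ s, 0 ≤ (lam β).re) : 0 ≤ (lam (∑ β ∈ s, c β • β)).re := by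
  simp only [map_sum, map_smul, Complex.re_sum, Complex.smul_re, smul_eq_mul]
  exact Finset.sum_nonneg fun β hβ => mul_nonneg (hc β) (hs β hβ)

/-- If `λ ∈ V*_ℂ` has `Re λ(α∨) ≥ 0` for all `α ∈ Σ₀⁺` and satisfies
`e^{λ(φ∨)} = ∏_{α∈Σ₀⁺} ((λ(α∨) − k_α)/(λ(α∨) + k_α))^{α(φ∨)}`, then `λ` is purely
imaginary: `Re λ(α∨) = 0` for all `α ∈ Σ₀`. -/
theorem statement15
    {V : Type*} [NormedAddCommGroup V] [InnerProductSpace ℝ V] [FiniteDimensional ℝ V]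
    (R : RootSystemBase V) (k : V → ℝ) (hk : IsMultiplicity R k)
    (m : V → ℕ) (hm : ∀ α ∈ R.pos, ⟪α, coroot R.hroot⟫ = (m α : ℝ))
    (lam : V →ₗ[ℝ] ℂ)
    (hre : ∀ α ∈ R.pos, 0 ≤ (lam (coroot α)).re)
    (hbae : Complex.exp (lam (coroot R.hroot)) =
      ∏ α ∈ R.pos,
        ((lam (coroot α) - (k α : ℂ)) / (lam (coroot α) + (k α : ℂ))) ^ (m α)) :
    ∀ α ∈ R.roots, (lam (coroot α)).re = 0 := by
  have scale_pos : ∀ α ∈ R.roots, 0 < 2 / ‖α‖ ^ 2 := fun α hα => by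
    have := norm_pos_iff.mpr (R.ne_zero α hα)
    positivity
  have re_nonneg : ∀ α ∈ R.pos, 0 ≤ (lam α).re := fun α hα => by
    have h := hre α hα
    rw [re_map_coroot] at h
    exact nonneg_of_mul_nonneg_right h (scale_pos α (R.pos_sub hα))
  have hroot_le : (lam R.hroot).re ≤ 0 := by
    have h : ‖Complex.exp (lam (coroot R.hroot))‖ ≤ 1 := by
      rw [hbae, norm_prod]
      refine Finset.prod_le_one (fun _ _ => norm_nonneg _) fun α hα => ?_
      rw [norm_pow]
      exact pow_le_one₀ (norm_nonneg _)
        (norm_sub_div_add_ofReal_le_one (hre α hα) (hk.1 α (R.pos_sub hα)))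
    rw [Complex.norm_exp, Real.exp_le_one_iff, re_map_coroot] at h
    exact nonpos_of_mul_nonpos_right h (scale_pos _ (R.pos_sub R.hroot_pos))
  have pos_zero : ∀ α ∈ R.pos, (lam α).re = 0 := fun α hα => by
    obtain ⟨c, hc, h⟩ := R.hroot_highest α (R.pos_sub hα)
    have hsum := re_map_sum_smul_nonneg lam hc fun β hβ => re_nonneg β (R.simples_sub_pos hβ)
    rw [← h, map_sub, Complex.sub_re] at hsum
    linarith [re_nonneg α hα]
  intro α hα
  rw [re_map_coroot, mul_eq_zero]
  right
  rcases R.pos_or_neg α hα with h | h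
  · exact pos_zero α h.1
  · simpa using pos_zero (-α) h.2

end
end
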